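/- arXiv:1004.3523 — 2 statements merged into one kernel-verified Lean document; each statement's English description precedes it below -/
import Mathlib

section
/- Let 1 < R₀ < R₁ be reals, let α₀ > 0 satisfy α₀ + R₀(e^{−α₀} − 1) = 0, let α₁ > 0, let ε ∈ (0,1) and D > 0 satisfy e^{−α₁ D} < ε, and let t_s ≥ 0 satisfy t_s ≥ (R₀/(R₁ − R₀))·[(1/α₀)·log(1/(ε − e^{−α₁ D})) − D]. Then ∑_{k=0}^{∞} e^{−α₀(D + k − t_s)} · e^{−R₁ t_s}(R₁ t_s)^k / k! ≤ ε − e^{−α₁ D}. (In particular the series equals exp(−α₀(D − t_s) + R₁ t_s (e^{−α₀} − 1)), and this closed form is at most ε − e^{−α₁ D}.) -/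
open scoped Nat

/-- Key series bound in the feasibility proof of the off-line policy: if `α₀` is the positive
root of `γ_{R₀}`, `e^{-α₁ D} < ε`, and the switching time `t_s` is at least
`(R₀/(R₁-R₀)) [ (1/α₀) log(1/(ε - e^{-α₁ D})) - D ]`, then the expectation of
`e^{-α₀ (D + K - t_s)}` for `K` Poisson with mean `R₁ t_s` has the stated closed form and is
at most `ε - e^{-α₁ D}`. -/
theorem offline_series_bound (R₀ R₁ α₀ α₁ ε D ts : ℝ)
    (hR₀ : 1 < R₀) (hR₀₁ : R₀ < R₁)
    (hα₀_pos : 0 < α₀) (hα₀_root : α₀ + R₀ * (Real.exp (-α₀) - 1) = 0)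
    (hα₁_pos : 0 < α₁) (hε_pos : 0 < ε) (hε_lt : ε < 1) (hD : 0 < D)
    (hfeas : Real.exp (-(α₁ * D)) < ε) (hts_nonneg : 0 ≤ ts)
    (hts : ts ≥ R₀ / (R₁ - R₀) *
      (1 / α₀ * Real.log (1 / (ε - Real.exp (-(α₁ * D)))) - D)) :
    (∑' k : ℕ, Real.exp (-(α₀ * (D + k - ts))) *
        (Real.exp (-(R₁ * ts)) * (R₁ * ts) ^ k / (k !)) =
      Real.exp (-(α₀ * (D - ts)) + R₁ * ts * (Real.exp (-α₀) - 1))) ∧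
    ∑' k : ℕ, Real.exp (-(α₀ * (D + k - ts))) *
        (Real.exp (-(R₁ * ts)) * (R₁ * ts) ^ k / (k !)) ≤
      ε - Real.exp (-(α₁ * D)) := by
  have hsum : ∑' k : ℕ, Real.exp (-(α₀ * (D + k - ts))) *
        (Real.exp (-(R₁ * ts)) * (R₁ * ts) ^ k / (k !)) =
      Real.exp (-(α₀ * (D - ts)) + R₁ * ts * (Real.exp (-α₀) - 1)) := by
    have hterm : ∀ k : ℕ, Real.exp (-(α₀ * (D + k - ts))) *
        (Real.exp (-(R₁ * ts)) * (R₁ * ts) ^ k / (k !)) =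
        Real.exp (-(α₀ * (D - ts)) - R₁ * ts) *
          ((R₁ * ts * Real.exp (-α₀)) ^ k / (k !)) := by
      intro k
      have h1 : Real.exp (-(α₀ * (D + k - ts))) =
          Real.exp (-(α₀ * (D - ts))) * Real.exp (-α₀) ^ k := by
        rw [← Real.exp_nat_mul, ← Real.exp_add]
        congr 1
        ring
      rw [h1, sub_eq_add_neg (-(α₀ * (D - ts))), Real.exp_add, mul_pow]
      ring
    have hexp : HasSum (fun k : ℕ => (R₁ * ts * Real.exp (-α₀)) ^ k / (k ! : ℝ))
        (Real.exp (R₁ * ts * Real.exp (-α₀))) := by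
      rw [Real.exp_eq_exp_ℝ]
      exact NormedSpace.expSeries_div_hasSum_exp _
    simp_rw [hterm]
    rw [tsum_mul_left, hexp.tsum_eq, ← Real.exp_add]
    congr 1
    ring
  refine ⟨hsum, ?_⟩
  rw [hsum]
  have hδ : 0 < ε - Real.exp (-(α₁ * D)) := sub_pos.mpr hfeas
  generalize ε - Real.exp (-(α₁ * D)) = δ at hδ hts
  rw [← Real.le_log_iff_exp_le hδ]
  have hR : 0 < R₀ := by linarith
  have hd : 0 < R₁ - R₀ := by linarith
  have he : Real.exp (-α₀) - 1 = -α₀ / R₀ := by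
    field_simp
    linarith
  rw [one_div δ, Real.log_inv] at hts
  have h2 : 1 / α₀ * (-Real.log δ) - D ≤ ts * (R₁ - R₀) / R₀ := by
    rw [le_div_iff₀ hR]
    rw [ge_iff_le, div_mul_eq_mul_div, div_le_iff₀ hd] at hts
    linarith
  have h3 := mul_le_mul_of_nonneg_left h2 hα₀_pos.le
  have h4 : α₀ * (1 / α₀ * (-Real.log δ) - D) = -Real.log δ - α₀ * D := by
    field_simp
  have h5 : -(α₀ * (D - ts)) + R₁ * ts * (-α₀ / R₀) =
      -(α₀ * D) - α₀ * (ts * (R₁ - R₀) / R₀) := by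
    field_simp
    ring
  rw [he, h5]
  linarith
end

section
/- Let (Ω, μ) be a probability space and Z : Ω → ℝ a random variable with 0 ≤ Z ≤ 1 almost surely and E[Z] > 0. Let α₀, α₁ be reals with 0 < α₀ ≤ α₁ and α₀ < 2. Then E[1 − e^{−α₁ Z}] ≤ (α₁ / (α₀(1 − α₀/2))) · E[1 − e^{−α₀ Z}]. -/
open MeasureTheory

theorem exp_neg_le_quadratic {x : ℝ} (hx : 0 ≤ x) :
    Real.exp (-x) ≤ 1 - x + x ^ 2 / 2 := by
  have h := Real.quadratic_le_exp_of_nonneg hx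
  have hq : 0 ≤ 1 - x + x ^ 2 / 2 := by nlinarith [sq_nonneg (x - 1)]
  rw [Real.exp_neg, inv_le_iff_one_le_mul₀ (Real.exp_pos x)]
  have := mul_le_mul_of_nonneg_left h hq
  nlinarith [sq_nonneg (x ^ 2)]

/-- Overshoot bound: if `Z` is a random variable with `0 ≤ Z ≤ 1` a.s. and `E[Z] > 0`,
and `0 < α₀ ≤ α₁` with `α₀ < 2`, then
`E[1 - e^{-α₁ Z}] ≤ (α₁ / (α₀ (1 - α₀/2))) E[1 - e^{-α₀ Z}]`. -/
theorem overshoot_exp_bound {Ω : Type*} [MeasurableSpace Ω] (μ : Measure Ω)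
    [IsProbabilityMeasure μ] (Z : Ω → ℝ) (hZ : Measurable Z)
    (hZ01 : ∀ᵐ ω ∂μ, 0 ≤ Z ω ∧ Z ω ≤ 1) (hZpos : 0 < ∫ ω, Z ω ∂μ)
    (α₀ α₁ : ℝ) (hα₀ : 0 < α₀) (hα₀₁ : α₀ ≤ α₁) (hα₀2 : α₀ < 2) :
    ∫ ω, (1 - Real.exp (-(α₁ * Z ω))) ∂μ ≤
      α₁ / (α₀ * (1 - α₀ / 2)) * ∫ ω, (1 - Real.exp (-(α₀ * Z ω))) ∂μ := by
  have hint : ∀ a : ℝ, 0 < a → Integrable (fun ω => 1 - Real.exp (-(a * Z ω))) μ := by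
    intro a ha
    refine Integrable.of_bound (C := 1) (by fun_prop) ?_
    filter_upwards [hZ01] with ω h
    have h1 : Real.exp (-(a * Z ω)) ≤ 1 := by
      rw [Real.exp_le_one_iff]
      have := mul_nonneg ha.le h.1
      linarith
    have h2 := Real.exp_pos (-(a * Z ω))
    rw [Real.norm_eq_abs, abs_le]
    constructor <;> linarith
  have hc : 0 < α₀ * (1 - α₀ / 2) := mul_pos hα₀ (by linarith)
  have hα₁ : 0 < α₁ := lt_of_lt_of_le hα₀ hα₀₁
  rw [← integral_const_mul]
  refine integral_mono_ae (hint α₁ hα₁) ((hint α₀ hα₀).const_mul _) ?_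
  filter_upwards [hZ01] with ω h
  have h1 := Real.one_sub_le_exp_neg (α₁ * Z ω)
  have h2 := exp_neg_le_quadratic (mul_nonneg hα₀.le h.1)
  have h3 : α₀ * (1 - α₀ / 2) * Z ω ≤ 1 - Real.exp (-(α₀ * Z ω)) := by
    have : 0 ≤ α₀ ^ 2 * (Z ω * (1 - Z ω)) :=
      mul_nonneg (sq_nonneg _) (mul_nonneg h.1 (by linarith [h.2]))
    nlinarith
  calc 1 - Real.exp (-(α₁ * Z ω)) ≤ α₁ * Z ω := by linarith
    _ = α₁ / (α₀ * (1 - α₀ / 2)) * (α₀ * (1 - α₀ / 2) * Z ω) := by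
      rw [← mul_assoc, div_mul_cancel₀ _ hc.ne']
    _ ≤ _ := mul_le_mul_of_nonneg_left h3 (div_pos hα₁ hc).le
end
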